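/- Let (a_n)_{n≥1} be a sequence of distinct positive real numbers such that inf_{1≤m≠n≤N} |a_m − a_n| ≥ c(N) for all N, where (c(N))_{N≥1} is a monotone decreasing sequence of positive reals, and let ε > 0. Then for almost all α ∈ [0,1] there exists N₀(α) such that for all N ≥ N₀(α), δ_min^α(N) ≥ c(N) / (D_N · log N · (log₂ N)^{1+ε}). -/

import Mathlib

open MeasureTheory Filter

/-- Distance from a real number to the nearest integer. -/
noncomputable def nint (x : ℝ) : ℝ := |x - round x|

/-- `deltaMin a α N` is the minimal gap
`min { ‖α (a_m − a_n)‖ : 1 ≤ m ≠ n ≤ N }`. -/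
noncomputable def deltaMin (a : ℕ → ℝ) (α : ℝ) (N : ℕ) : ℝ :=
  sInf {d : ℝ | ∃ m n : ℕ, 1 ≤ m ∧ m ≤ N ∧ 1 ≤ n ∧ n ≤ N ∧ m ≠ n ∧
    d = nint (α * (a m - a n))}

/-- `Dcard a N` is the number of distinct positive differences
`#{ |a_m − a_n| : 1 ≤ m ≠ n ≤ N }`. -/
noncomputable def Dcard (a : ℕ → ℝ) (N : ℕ) : ℕ :=
  Set.ncard {x : ℝ | ∃ m n : ℕ, 1 ≤ m ∧ m ≤ N ∧ 1 ≤ n ∧ n ≤ N ∧ m ≠ n ∧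
    x = |a m - a n|}

/-- `Log x = max (1, log x)`. -/
noncomputable def Log (x : ℝ) : ℝ := max 1 (Real.log x)

/-- Iterated logarithm `log₂ x = Log (Log x)`. -/
noncomputable def Log2 (x : ℝ) : ℝ := Log (Log x)

/-- The finite set of distances `|a m - a n|` between distinct indices in `[1, N]`. -/
noncomputable def gaps (a : ℕ → ℝ) (N : ℕ) : Finset ℝ :=
  (Finset.Icc 1 N).offDiag.image fun p => |a p.1 - a p.2|

theorem mem_gaps {a : ℕ → ℝ} {N : ℕ} {x : ℝ} :
    x ∈ gaps a N ↔ ∃ m n : ℕ, 1 ≤ m ∧ m ≤ N ∧ 1 ≤ n ∧ n ≤ N ∧ m ≠ n ∧ x = |a m - a n| := by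
  simp only [gaps, Finset.mem_image, Finset.mem_offDiag, Finset.mem_Icc, Prod.exists]
  constructor
  · rintro ⟨m, n, ⟨⟨h1, h2⟩, ⟨h3, h4⟩, h5⟩, rfl⟩
    exact ⟨m, n, h1, h2, h3, h4, h5, rfl⟩
  · rintro ⟨m, n, h1, h2, h3, h4, h5, rfl⟩
    exact ⟨m, n, ⟨⟨h1, h2⟩, ⟨h3, h4⟩, h5⟩, rfl⟩

theorem Dcard_eq_card_gaps (a : ℕ → ℝ) (N : ℕ) : Dcard a N = (gaps a N).card := by
  rw [← Set.ncard_coe_finset, Dcard]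
  congr 1
  ext x
  rw [Finset.mem_coe, mem_gaps]
  rfl

theorem gaps_mono (a : ℕ → ℝ) {M N : ℕ} (h : M ≤ N) : gaps a M ⊆ gaps a N := by
  intro x hx
  rw [mem_gaps] at hx ⊢
  obtain ⟨m, n, h1, h2, h3, h4, h5, rfl⟩ := hx
  exact ⟨m, n, h1, h2.trans h, h3, h4.trans h, h5, rfl⟩

theorem card_gaps_le (a : ℕ → ℝ) (N : ℕ) : (gaps a N).card ≤ N ^ 2 := by
  refine Finset.card_image_le.trans ?_
  rw [Finset.offDiag_card, Nat.card_Icc, Nat.add_sub_cancel, sq]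
  exact Nat.sub_le _ _

/-- Measuring from the largest of `N` distinct terms gives `N - 1` distinct gaps. -/
theorem le_card_gaps_add_one {a : ℕ → ℝ}
    (hdist : ∀ m n, 1 ≤ m → 1 ≤ n → m ≠ n → a m ≠ a n) (N : ℕ) :
    N ≤ (gaps a N).card + 1 := by
  rcases Nat.eq_zero_or_pos N with rfl | hN
  · exact Nat.zero_le _
  obtain ⟨M, hM, hmax⟩ := Finset.exists_max_image (Finset.Icc 1 N) a ⟨1, by simp; omega⟩
  have hcard : ((Finset.Icc 1 N).erase M).card + 1 = N := by
    rw [Finset.card_erase_add_one hM, Nat.card_Icc, Nat.add_sub_cancel]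
  have hle : ((Finset.Icc 1 N).erase M).card ≤ (gaps a N).card := by
    refine Finset.card_le_card_of_injOn (fun n => a M - a n) ?_ ?_
    · intro n hn
      simp only [Finset.coe_erase, Set.mem_sdiff, Finset.mem_coe, Set.mem_singleton_iff] at hn
      have h1 := Finset.mem_Icc.1 hn.1
      have h2 := Finset.mem_Icc.1 hM
      exact mem_gaps.2 ⟨M, n, h2.1, h2.2, h1.1, h1.2, Ne.symm hn.2,
        (abs_of_nonneg (sub_nonneg.2 (hmax n hn.1))).symm⟩
    · intro m hm n hn hmn
      simp only [Finset.coe_erase, Set.mem_sdiff, Finset.mem_coe, Finset.mem_Icc] at hm hn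
      by_contra hne
      exact hdist m n hm.1.1 hn.1.1 hne (by simpa using hmn)
  omega

theorem nint_neg (x : ℝ) : nint (-x) = nint x := by
  simp only [nint, ← UnitAddCircle.norm_eq, AddCircle.coe_neg, norm_neg]

theorem nint_mul_abs (α x : ℝ) : nint (α * |x|) = nint (α * x) := by
  rcases abs_choice x with h | h <;> rw [h]
  rw [mul_neg, nint_neg]

theorem volume_nint_mul_lt_le {d t : ℝ} (hd : 0 < d) (ht : 0 ≤ t) :
    volume (Set.Icc (0 : ℝ) 1 ∩ {α | nint (α * d) < t}) ≤ ENNReal.ofReal (2 * t + 3 * (t / d)) := by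
  have hsub : Set.Icc (0 : ℝ) 1 ∩ {α | nint (α * d) < t} ⊆
      ⋃ k ∈ Finset.range (⌊d + 1 / 2⌋₊ + 1), Set.Ioo (((k : ℝ) - t) / d) ((k + t) / d) := by
    rintro α ⟨⟨h0, h1⟩, hα⟩
    simp only [Set.mem_ofPred_eq, nint, abs_lt] at hα
    have hαd : 0 ≤ α * d := by positivity
    have hround : 0 ≤ round (α * d) := by
      rw [round_eq]
      positivity
    obtain ⟨k, hk⟩ := Int.eq_ofNat_of_zero_le hround
    have hr := abs_le.1 (abs_sub_round (α * d))
    rw [hk] at hα hr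
    push_cast at hα hr
    simp only [Set.mem_iUnion, Finset.mem_range, Set.mem_Ioo, exists_prop]
    refine ⟨k, Nat.lt_succ_of_le (Nat.le_floor ?_), ?_, ?_⟩
    · nlinarith [hr.1]
    · rw [div_lt_iff₀ hd]
      linarith [hα.1]
    · rw [lt_div_iff₀ hd]
      linarith [hα.2]
  refine (measure_mono hsub).trans ((measure_biUnion_finset_le _ _).trans ?_)
  simp only [Real.volume_Ioo]
  rw [← ENNReal.ofReal_sum_of_nonneg]
  · refine ENNReal.ofReal_le_ofReal ?_
    have hterm : ∀ k ∈ Finset.range (⌊d + 1 / 2⌋₊ + 1),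
        ((k : ℝ) + t) / d - ((k : ℝ) - t) / d = 2 * (t / d) := by
      intro k _
      ring
    rw [Finset.sum_congr rfl hterm, Finset.sum_const, Finset.card_range, nsmul_eq_mul]
    have hfl : ((⌊d + 1 / 2⌋₊ + 1 : ℕ) : ℝ) ≤ d + 3 / 2 := by
      push_cast
      linarith [Nat.floor_le (show 0 ≤ d + 1 / 2 by linarith)]
    calc _ ≤ (d + 3 / 2) * (2 * (t / d)) := by gcongr
      _ = _ := by field_simp
  · intro k _
    rw [← sub_div]
    apply div_nonneg _ hd.le
    linarith

/-- A lower bound for `Log N * Log2 N ^ (1 + ε)` valid whenever `2 ^ k ≤ N ^ 2`. -/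
noncomputable def logWeight (ε : ℝ) (k : ℕ) : ℝ :=
  max 1 ((k : ℝ) / 4) * Log (max 1 ((k : ℝ) / 4)) ^ (1 + ε)

theorem Log_pos (x : ℝ) : 0 < Log x := zero_lt_one.trans_le (le_max_left _ _)

theorem Log_le_Log {x y : ℝ} (hx : 0 < x) (h : x ≤ y) : Log x ≤ Log y :=
  max_le_max le_rfl (Real.log_le_log hx h)

theorem logWeight_pos (ε : ℝ) (k : ℕ) : 0 < logWeight ε k :=
  mul_pos (by positivity) (Real.rpow_pos_of_pos (Log_pos _) _)

theorem logWeight_mono {ε : ℝ} (hε : 0 < ε) {j k : ℕ} (h : j ≤ k) :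
    logWeight ε j ≤ logWeight ε k := by
  have h' : max 1 ((j : ℝ) / 4) ≤ max 1 ((k : ℝ) / 4) := by gcongr
  exact mul_le_mul h' (Real.rpow_le_rpow (Log_pos _).le
    (Log_le_Log (by positivity) h') (by linarith))
    (Real.rpow_nonneg (Log_pos _).le _) (by positivity)

theorem logWeight_le {ε : ℝ} (hε : 0 < ε) {k N : ℕ} (h : 2 ^ k ≤ N ^ 2) :
    logWeight ε k ≤ Log N * Log2 N ^ (1 + ε) := by
  have hlog : (k : ℝ) * Real.log 2 ≤ 2 * Real.log N := by
    have h' : ((2 : ℝ) ^ k) ≤ (N : ℝ) ^ 2 := by exact_mod_cast h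
    have := Real.log_le_log (by positivity) h'
    rw [Real.log_pow, Real.log_pow] at this
    exact_mod_cast this
  have hmax : max 1 ((k : ℝ) / 4) ≤ Log N := by
    refine max_le_max le_rfl ?_
    have hk : (0 : ℝ) ≤ k := k.cast_nonneg
    nlinarith [Real.log_two_gt_d9]
  exact mul_le_mul hmax (Real.rpow_le_rpow (Log_pos _).le
    (Log_le_Log (by positivity) hmax) (by linarith))
    (Real.rpow_nonneg (Log_pos _).le _) (Log_pos _).le

theorem summable_inv_logWeight {ε : ℝ} (hε : 0 < ε) : Summable fun k => (logWeight ε k)⁻¹ := by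
  rw [← summable_condensed_iff_of_nonneg (fun k => (inv_pos.2 (logWeight_pos ε k)).le)
    (fun j k _ h => inv_anti₀ (logWeight_pos ε _) (logWeight_mono hε h))]
  have hs : Summable fun j : ℕ => 4 * 5 ^ (1 + ε) * (1 / ((j + 1 : ℕ) : ℝ) ^ (1 + ε)) :=
    ((summable_nat_add_iff 1).2
      (Real.summable_one_div_nat_rpow.2 (show 1 < 1 + ε by linarith))).mul_left _
  refine Summable.of_nonneg_of_le
    (fun j => mul_nonneg (by positivity) (inv_pos.2 (logWeight_pos ε _)).le) (fun j => ?_) hs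
  have hlog : ((j + 1 : ℕ) : ℝ) / 5 ≤ Log (max 1 (((2 ^ j : ℕ) : ℝ) / 4)) := by
    rcases le_total j 4 with hj | hj
    · refine le_max_of_le_left ?_
      have : (j : ℝ) ≤ 4 := by exact_mod_cast hj
      push_cast
      linarith
    · refine le_max_of_le_right ?_
      have hj' : (4 : ℝ) ≤ j := by exact_mod_cast hj
      have := Real.log_le_log (by positivity) (le_max_right 1 (((2 ^ j : ℕ) : ℝ) / 4))
      rw [Real.log_div (by positivity) (by norm_num), show (4 : ℝ) = 2 ^ 2 by norm_num] at this
      push_cast at this ⊢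
      rw [Real.log_pow, Real.log_pow] at this
      norm_num at this ⊢
      nlinarith [Real.log_two_gt_d9]
  have hw : (2 : ℝ) ^ j / 4 * (((j + 1 : ℕ) : ℝ) / 5) ^ (1 + ε) ≤ logWeight ε (2 ^ j) := by
    refine mul_le_mul ?_ (Real.rpow_le_rpow (by positivity) hlog (by linarith))
      (by positivity) (by positivity)
    push_cast
    exact le_max_right _ _
  calc (2 : ℝ) ^ j * (logWeight ε (2 ^ j))⁻¹
      ≤ 2 ^ j * ((2 : ℝ) ^ j / 4 * (((j + 1 : ℕ) : ℝ) / 5) ^ (1 + ε))⁻¹ := by gcongr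
    _ = _ := by
      rw [Real.div_rpow (by positivity) (by norm_num)]
      field_simp

/-- The `α ∈ [0, 1]` for which some gap `d` in the finite set `s` has `‖α d‖` below
`min d C / (2 ^ k * logWeight ε k)`. -/
noncomputable def badSet (s : Finset ℝ) (C ε : ℝ) (k : ℕ) : Set ℝ :=
  ⋃ d ∈ s, Set.Icc (0 : ℝ) 1 ∩ {α | nint (α * d) < min d C / (2 ^ k * logWeight ε k)}

theorem volume_badSet_le {s : Finset ℝ} {C ε : ℝ} {k : ℕ} (hC : 0 ≤ C)
    (hs : ∀ d ∈ s, 0 < d) (hcard : s.card ≤ 2 ^ (k + 1)) :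
    volume (badSet s C ε k) ≤ ENNReal.ofReal ((4 * C + 6) * (logWeight ε k)⁻¹) := by
  have hw := logWeight_pos ε k
  have hd : ∀ d ∈ s, volume (Set.Icc (0 : ℝ) 1 ∩
      {α | nint (α * d) < min d C / (2 ^ k * logWeight ε k)}) ≤
      ENNReal.ofReal ((2 * C + 3) / (2 ^ k * logWeight ε k)) := by
    intro d hds
    have hd0 := hs d hds
    refine (volume_nint_mul_lt_le hd0 (by positivity)).trans (ENNReal.ofReal_le_ofReal ?_)
    have h1 : min d C / (2 ^ k * logWeight ε k) ≤ C / (2 ^ k * logWeight ε k) := by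
      gcongr
      exact min_le_right _ _
    have h2 : min d C / (2 ^ k * logWeight ε k) / d ≤ 1 / (2 ^ k * logWeight ε k) := by
      rw [div_right_comm]
      gcongr
      exact (div_le_one hd0).2 (min_le_left _ _)
    calc _ ≤ 2 * (C / (2 ^ k * logWeight ε k)) + 3 * (1 / (2 ^ k * logWeight ε k)) := by gcongr
      _ = _ := by ring
  refine (measure_biUnion_finset_le _ _).trans ((Finset.sum_le_sum hd).trans ?_)
  rw [Finset.sum_const, ← ENNReal.ofReal_nsmul, nsmul_eq_mul]
  refine ENNReal.ofReal_le_ofReal ?_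
  have hcard' : (s.card : ℝ) ≤ 2 ^ (k + 1) := by exact_mod_cast hcard
  calc _ ≤ 2 ^ (k + 1) * ((2 * C + 3) / (2 ^ k * logWeight ε k)) := by gcongr
    _ = _ := by
      field_simp
      ring

theorem ae_eventually_notMem_badSet {s : ℕ → Finset ℝ} {C ε : ℝ} (hC : 0 ≤ C) (hε : 0 < ε)
    (hs : ∀ k, ∀ d ∈ s k, 0 < d) (hcard : ∀ k, (s k).card ≤ 2 ^ (k + 1)) :
    ∀ᵐ α, ∀ᶠ k in atTop, α ∉ badSet (s k) C ε k := by
  refine ae_eventually_notMem (ne_top_of_le_ne_top ?_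
    (ENNReal.tsum_le_tsum fun k => volume_badSet_le hC (hs k) (hcard k)))
  exact ((summable_inv_logWeight hε).mul_left _).tsum_ofReal_ne_top


theorem stmt2 (a : ℕ → ℝ) (c : ℕ → ℝ)
    (hcpos : ∀ N, 1 ≤ N → 0 < c N)
    (hcmono : ∀ M N, 1 ≤ M → M ≤ N → c N ≤ c M)
    (hpos : ∀ n, 1 ≤ n → 0 < a n)
    (hdist : ∀ m n, 1 ≤ m → 1 ≤ n → m ≠ n → a m ≠ a n)
    (hsep : ∀ N m n, 1 ≤ m → m ≤ N → 1 ≤ n → n ≤ N → m ≠ n → c N ≤ |a m - a n|)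
    (ε : ℝ) (hε : 0 < ε) :
    ∀ᵐ α ∂(volume.restrict (Set.Icc (0:ℝ) 1)),
      ∃ N₀ : ℕ, ∀ N, N₀ ≤ N →
        c N / ((Dcard a N : ℝ) * Log (N : ℝ) * Log2 (N : ℝ) ^ (1 + ε)) ≤
          deltaMin a α N := by
  have hgap : ∀ N, ∀ d ∈ gaps a N, 0 < d := by
    intro N d hd
    obtain ⟨m, n, h1, h2, h3, h4, h5, rfl⟩ := mem_gaps.1 hd
    exact abs_pos.2 (sub_ne_zero.2 (hdist m n h1 h3 h5))
  let P : ℕ → ℕ → Prop := fun k N => (gaps a N).card < 2 ^ (k + 1)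
  let s : ℕ → Finset ℝ := fun k => gaps a (Nat.findGreatest (P k) (2 ^ (k + 1)))
  have hcard : ∀ k, (s k).card ≤ 2 ^ (k + 1) := fun k =>
    (Nat.findGreatest_spec (P := P k) (Nat.zero_le _) (by simp [P, gaps])).le
  have hae := ae_eventually_notMem_badSet (hcpos 1 le_rfl).le hε (fun k => hgap _) hcard
  rw [ae_restrict_iff' measurableSet_Icc]
  filter_upwards [hae] with α hα hα01
  obtain ⟨K, hK⟩ := eventually_atTop.1 hα
  refine ⟨2 ^ K + 1, fun N hN => ?_⟩
  have hN2 : 2 ≤ N := by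
    have := Nat.one_le_two_pow (n := K)
    omega
  have hlow := le_card_gaps_add_one hdist N
  have hD0 : (gaps a N).card ≠ 0 := by omega
  set k := Nat.log 2 (gaps a N).card with hk
  have hKk : K ≤ k := Nat.le_log_of_pow_le (by norm_num) (by omega)
  have hkD : 2 ^ k ≤ (gaps a N).card := Nat.pow_log_le_self 2 hD0
  have hDk : (gaps a N).card < 2 ^ (k + 1) := Nat.lt_pow_succ_log_self (by norm_num) _
  have hsub : gaps a N ⊆ s k :=
    gaps_mono a (Nat.le_findGreatest (P := P k) (by omega) hDk)
  refine le_csInf ⟨_, 1, 2, le_rfl, by omega, by omega, hN2, by omega, rfl⟩ ?_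
  rintro _ ⟨m, n, h1, h2, h3, h4, h5, rfl⟩
  have hmem : |a m - a n| ∈ gaps a N := mem_gaps.2 ⟨m, n, h1, h2, h3, h4, h5, rfl⟩
  have hnot : ¬ nint (α * |a m - a n|) <
      min |a m - a n| (c 1) / (2 ^ k * logWeight ε k) := fun hlt =>
    hK k hKk (Set.mem_biUnion (hsub hmem) ⟨hα01, hlt⟩)
  rw [nint_mul_abs, not_lt] at hnot
  refine le_trans ?_ hnot
  have hw := logWeight_pos ε k
  rw [Dcard_eq_card_gaps, mul_assoc]
  refine div_le_div₀ (le_min (abs_nonneg _) (hcpos 1 le_rfl).le)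
    (le_min (hsep N m n h1 h2 h3 h4 h5) (hcmono 1 N le_rfl (by omega))) (by positivity) ?_
  refine mul_le_mul (by exact_mod_cast hkD) (logWeight_le hε (hkD.trans (card_gaps_le a N)))
    hw.le (by positivity)
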